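/- Assume m,n → ∞ with m/n → μ ∈ (0,∞), P^{(n)} → P weakly, and P^{(n)}_{rs} → P_{rs} < ∞ for (r,s) = (1,0), (2,1), (3,2), (4,3), with P_{10} > 0. Then the third moments of the model degree distribution f_n of G_n converge to the (finite) third moment of the limiting compound Poisson degree distribution \bar f_1: Σ_s s³ f_n(s) → Σ_s s³ \bar f_1(s) < ∞. -/

import Mathlib

open MeasureTheory ProbabilityTheory Filter
open scoped ENNReal Topology Classical

noncomputable section

/-- The binomial probability mass function `Bin(x,y)(s)`. -/
def binP (x : ℕ) (y : ℝ) (s : ℕ) : ℝ := (x.choose s : ℝ) * y ^ s * (1 - y) ^ (x - s)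

/-- Convolution of (mass) functions on `ℕ`. -/
def conv (f g : ℕ → ℝ) (s : ℕ) : ℝ := ∑ i ∈ Finset.range (s + 1), f i * g (s - i)

/-- Iterated convolution power: `convPow f j` is the `j`-fold convolution of `f`. -/
def convPow (f : ℕ → ℝ) : ℕ → ℕ → ℝ
  | 0 => fun s => if s = 0 then 1 else 0
  | j + 1 => conv f (convPow f j)

/-- The compound Poisson probability mass function `CPoi(lam, f)`, i.e. the law of
`H_1 + ⋯ + H_Λ` where `Λ ~ Poi(lam)` and the `H_k` are i.i.d. with mass function `f`,
independent of `Λ`. -/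
def cpoi (lam : ℝ) (f : ℕ → ℝ) (s : ℕ) : ℝ :=
  ∑' j : ℕ, Real.exp (-lam) * lam ^ j / (j.factorial : ℝ) * convPow f j s

/-- Convolution of (mass) functions on `ℕ × ℕ`. -/
def conv2 (F G : ℕ → ℕ → ℝ) (s t : ℕ) : ℝ :=
  ∑ i ∈ Finset.range (s + 1), ∑ j ∈ Finset.range (t + 1), F i j * G (s - i) (t - j)

/-- Point mass at `(1,1)`, as a mass function on `ℕ × ℕ`. -/
def delta11 (s t : ℕ) : ℝ := if s = 1 ∧ t = 1 then 1 else 0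

/-- The cross moment `Q_{rs} = E[(X)_r Y^s]` of a layer type distribution `Q`,
where `(x)_r` is the falling factorial. -/
def mom (Q : Measure (ℕ × ℝ)) (r s : ℕ) : ℝ :=
  ∫ p, (p.1.descFactorial r : ℝ) * p.2 ^ s ∂Q

/-- The increment distribution `g(s) = ∫ Bin(x-1,y)(s) x P(dx,dy) / P₁₀`. -/
def gInc (P : Measure (ℕ × ℝ)) (s : ℕ) : ℝ :=
  (∫ p, (p.1 : ℝ) * binP (p.1 - 1) p.2 s ∂P) / mom P 1 0

/-- The limiting degree distribution `\bar f_1 = CPoi(μ P₁₀, g)`. -/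
def barf1 (mu : ℝ) (P : Measure (ℕ × ℝ)) (s : ℕ) : ℝ :=
  cpoi (mu * mom P 1 0) (gInc P) s

/-- The distribution `f₂'` of `(D₁', D₂')`:
`f₂'(s,t) = ∫ Bin(x-2,y)(s) Bin(x-2,y)(t) (x)₂ y P(dx,dy) / P₂₁`. -/
def f2p (P : Measure (ℕ × ℝ)) (s t : ℕ) : ℝ :=
  (∫ p, (p.1.descFactorial 2 : ℝ) * p.2 * binP (p.1 - 2) p.2 s * binP (p.1 - 2) p.2 t ∂P) /
    mom P 2 1

/-- The limiting bidegree distribution `\bar f₂ = δ₍₁,₁₎ ∗ (\bar f₁ ⊗ \bar f₁) ∗ f₂'`. -/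
def barf2 (mu : ℝ) (P : Measure (ℕ × ℝ)) : ℕ → ℕ → ℝ :=
  conv2 (conv2 delta11 fun s t => barf1 mu P s * barf1 mu P t) (f2p P)

instance (n : ℕ) : MeasurableSpace (Finset (Fin n)) := ⊤

/-- Bernoulli distribution on `Bool` with success probability `y` (truncated into `[0,1]`). -/
def bern (y : ℝ) : Measure Bool :=
  (PMF.bernoulli (min (Real.toNNReal y) 1) (min_le_right _ _)).toMeasure

instance (y : ℝ) : IsProbabilityMeasure (bern y) :=
  PMF.toMeasure.isProbabilityMeasure _

/-- The distribution of the indicator of one potential edge `e` of a layer with node set `V`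
and strength `y`: Bernoulli(`y`) if `e` is a non-loop pair inside `V`, and surely absent
otherwise. -/
def edgeFactor (n : ℕ) (V : Finset (Fin n)) (y : ℝ) (e : Sym2 (Fin n)) : Measure Bool :=
  if ¬ e.IsDiag ∧ ∀ v ∈ e, v ∈ V then bern y else Measure.dirac false

instance (n : ℕ) (V : Finset (Fin n)) (y : ℝ) (e : Sym2 (Fin n)) :
    IsProbabilityMeasure (edgeFactor n V y e) := by
  unfold edgeFactor; split <;> infer_instance

/-- Conditionally on the node set `V` and strength `y`, each non-loop pair of nodes of `V`
is linked independently with probability `y`. -/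
def edgeMeasure (n : ℕ) (V : Finset (Fin n)) (y : ℝ) : Measure (Sym2 (Fin n) → Bool) :=
  Measure.pi fun e => edgeFactor n V y e

/-- Uniformly random subset of the `n` nodes of size `x`. -/
def vertexMeasure (n x : ℕ) : Measure (Finset (Fin n)) :=
  if h : (Finset.powersetCard x (Finset.univ : Finset (Fin n))).Nonempty then
    (PMF.uniformOfFinset _ h).toMeasure
  else Measure.dirac ∅

/-- A sampled layer: its type `(x,y)`, its node set, and its edge indicators. -/
abbrev Layer (n : ℕ) := (ℕ × ℝ) × Finset (Fin n) × (Sym2 (Fin n) → Bool)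

/-- The distribution of a single layer with type distribution `Q`: the type `(x,y)` is
sampled from `Q`; conditionally on it, the node set is a uniformly random subset of size
`x` of the `n` nodes, and each pair of nodes of the node set is linked independently with
probability `y`. -/
def layerMeasure (n : ℕ) (Q : Measure (ℕ × ℝ)) : Measure (Layer n) :=
  Q.bind fun xy =>
    (vertexMeasure n xy.1).bind fun V =>
      (edgeMeasure n V xy.2).map fun f => (xy, V, f)

instance (n x : ℕ) : IsProbabilityMeasure (vertexMeasure n x) := by
  unfold vertexMeasure; split <;> infer_instance

instance (n : ℕ) (V : Finset (Fin n)) (y : ℝ) : IsProbabilityMeasure (edgeMeasure n V y) := by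
  unfold edgeMeasure; infer_instance

theorem measure_bind_univ_le {α β : Type*} [MeasurableSpace α] [MeasurableSpace β]
    (Q : Measure α) [IsProbabilityMeasure Q] {f : α → Measure β}
    (hf : ∀ a, f a Set.univ ≤ 1) : Q.bind f Set.univ ≤ 1 := by
  rw [Measure.bind, Measure.join_apply MeasurableSet.univ]
  by_cases hmeas : AEMeasurable f Q
  · rw [lintegral_map' (Measure.measurable_coe MeasurableSet.univ).aemeasurable hmeas]
    calc ∫⁻ a, f a Set.univ ∂Q ≤ ∫⁻ _, 1 ∂Q := lintegral_mono hf
      _ = 1 := by simp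
  · rw [Measure.map_of_not_aemeasurable hmeas]; simp

instance (n : ℕ) (Q : Measure (ℕ × ℝ)) [IsProbabilityMeasure Q] :
    IsFiniteMeasure (layerMeasure n Q) := by
  refine ⟨lt_of_le_of_lt ?_ ENNReal.one_lt_top⟩
  refine measure_bind_univ_le Q fun xy => ?_
  refine measure_bind_univ_le _ fun V => ?_
  have hg : Measurable fun f : Sym2 (Fin n) → Bool => ((xy, V, f) : Layer n) :=
    measurable_const.prodMk (measurable_const.prodMk measurable_id)
  rw [Measure.map_apply hg MeasurableSet.univ]
  simp

/-- The Bernoulli random graph superposition model `G_n` with `n` nodes and `m` mutually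
independent layers, each with type distribution `Q`. -/
def modelMeasure (n m : ℕ) (Q : Measure (ℕ × ℝ)) [IsProbabilityMeasure Q] :
    Measure (Fin m → Layer n) :=
  Measure.pi fun _ => layerMeasure n Q

/-- The edge set `E(G_{n,k})` of one layer. -/
def layerEdges {n : ℕ} (L : Layer n) : Finset (Sym2 (Fin n)) :=
  Finset.univ.filter fun e => L.2.2 e = true ∧ ¬ e.IsDiag ∧ ∀ v ∈ e, v ∈ L.2.1

/-- The edge set `E(G_n) = ⋃ₖ E(G_{n,k})` of the superposition graph. -/
def graphEdges {n m : ℕ} (ω : Fin m → Layer n) : Finset (Sym2 (Fin n)) :=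
  Finset.univ.biUnion fun k => layerEdges (ω k)

/-- The degree `deg_{G_n}(i)` of the node with label `i` (labels start from `0`). -/
def deg {n m : ℕ} (ω : Fin m → Layer n) (i : ℕ) : ℕ :=
  ((graphEdges ω).filter fun e => ∃ v : Fin n, v ∈ e ∧ (v : ℕ) = i).card

/-- The event that the first two nodes (labels `0` and `1`) are adjacent in `G_n`. -/
def adjEvent (n m : ℕ) : Set (Fin m → Layer n) :=
  {ω | ∃ e ∈ graphEdges ω, (∃ v : Fin n, v ∈ e ∧ (v : ℕ) = 0) ∧ ∃ v : Fin n, v ∈ e ∧ (v : ℕ) = 1}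

/-- The model bidegree distribution
`f_{2,n}(s,t) = P(deg(1) = s, deg(2) = t ∣ {1,2} ∈ E(G_n))`. -/
def bidegree (n m : ℕ) (Q : Measure (ℕ × ℝ)) [IsProbabilityMeasure Q] (s t : ℕ) : ℝ :=
  ((modelMeasure n m Q)[|adjEvent n m] {ω | deg ω 0 = s ∧ deg ω 1 = t}).toReal

theorem HasSum.of_eq {ι : Type*} {f g : ι → ℝ} {a b : ℝ} (h : HasSum f a)
    (hfg : ∀ i, g i = f i) (hab : b = a) : HasSum g b := by
  rw [funext hfg, hab]; exact h

section BinomialMoments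

theorem binP_nonneg {y : ℝ} (h0 : 0 ≤ y) (h1 : y ≤ 1) (x s : ℕ) : 0 ≤ binP x y s := by
  unfold binP
  have : 0 ≤ 1 - y := by linarith
  positivity

theorem hasSum_descFactorial_mul_binP (x : ℕ) (y : ℝ) (r : ℕ) :
    HasSum (fun s : ℕ => (s.descFactorial r : ℝ) * binP x y s)
      ((x.descFactorial r : ℝ) * y ^ r) := by
  have key : ∑ s ∈ Finset.range (x + 1), (s.descFactorial r : ℝ) * binP x y s
      = (x.descFactorial r : ℝ) * y ^ r := by
    rcases lt_or_ge x r with h | h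
    · rw [Nat.descFactorial_of_lt h]
      simp only [Nat.cast_zero, zero_mul]
      refine Finset.sum_eq_zero fun s hs => ?_
      rw [Nat.descFactorial_of_lt (by simp at hs; omega)]
      simp
    · obtain ⟨d, rfl⟩ := Nat.exists_eq_add_of_le h
      rw [show r + d + 1 = r + (d + 1) by ring, Finset.sum_range_add]
      rw [Finset.sum_eq_zero (s := Finset.range r), zero_add]
      · have hb := (add_pow y (1 - y) d).symm
        rw [add_sub_cancel, one_pow] at hb
        rw [← mul_one ((r + d).descFactorial r * y ^ r : ℝ), ← hb, Finset.mul_sum]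
        refine Finset.sum_congr rfl fun i hi => ?_
        have hi' : i ≤ d := by simp at hi; omega
        have hc := Nat.choose_mul (n := r + d) (k := r + i) (s := r) (by omega)
        have hc' : ((r + d).choose (r + i) : ℝ) * (r + i).choose r
            = (r + d).choose r * d.choose i := by
          have : r + d - r = d := by omega
          have h2 : r + i - r = i := by omega
          rw [this, h2] at hc
          exact_mod_cast hc
        rw [binP, Nat.descFactorial_eq_factorial_mul_choose,
          Nat.descFactorial_eq_factorial_mul_choose, show r + d - (r + i) = d - i by omega, pow_add]
        push_cast
        linear_combination (r.factorial : ℝ) * y ^ r * y ^ i * (1 - y) ^ (d - i) * hc'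
      · intro s hs
        rw [Nat.descFactorial_of_lt (by simpa using hs)]
        simp
  rw [← key]
  refine hasSum_sum_of_ne_finset_zero fun s hs => ?_
  rw [binP, Nat.choose_eq_zero_of_lt (by simp at hs; omega)]
  simp

end BinomialMoments

section IncrementMoments

theorem measurable_mass_mul_binP (s : ℕ) :
    Measurable fun p : ℕ × ℝ => (p.1 : ℝ) * binP (p.1 - 1) p.2 s := by
  refine measurable_from_prod_countable_right fun x => ?_
  simp only [binP]
  fun_prop

theorem hasSum_descFactorial_mul_gInc {P : Measure (ℕ × ℝ)} (r : ℕ)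
    (hP : ∀ᵐ p ∂P, p.2 ∈ Set.Icc (0 : ℝ) 1)
    (hint : Integrable (fun p : ℕ × ℝ => (p.1.descFactorial (r + 1) : ℝ) * p.2 ^ r) P) :
    HasSum (fun s : ℕ => (s.descFactorial r : ℝ) * gInc P s) (mom P (r + 1) r / mom P 1 0) := by
  have hfac : ∀ p : ℕ × ℝ, HasSum (fun s : ℕ => (s.descFactorial r : ℝ) *
      ((p.1 : ℝ) * binP (p.1 - 1) p.2 s)) ((p.1.descFactorial (r + 1) : ℝ) * p.2 ^ r) := by
    intro p
    have h := (hasSum_descFactorial_mul_binP (p.1 - 1) p.2 r).mul_left (p.1 : ℝ)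
    have e : ((p.1.descFactorial (r + 1) : ℕ) : ℝ) = p.1 * ((p.1 - 1).descFactorial r : ℕ) := by
      rcases p.1 with _ | x
      · simp
      · rw [Nat.succ_descFactorial_succ, Nat.add_sub_cancel]; push_cast; ring
    rw [e, mul_assoc]
    exact h.of_eq (fun s => by ring) rfl
  have h := hasSum_integral_of_dominated_convergence (μ := P)
    (F := fun s p => (s.descFactorial r : ℝ) * ((p.1 : ℝ) * binP (p.1 - 1) p.2 s))
    (f := fun p => (p.1.descFactorial (r + 1) : ℝ) * p.2 ^ r)
    (fun s p => (s.descFactorial r : ℝ) * ((p.1 : ℝ) * binP (p.1 - 1) p.2 s))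
    (fun s => ((measurable_mass_mul_binP s).const_mul _).aestronglyMeasurable)
    (fun s => by
      filter_upwards [hP] with p hp
      have := binP_nonneg hp.1 hp.2 (p.1 - 1) s
      rw [Real.norm_of_nonneg (by positivity)])
    (Eventually.of_forall fun p => (hfac p).summable)
    (hint.congr (Eventually.of_forall fun p => (hfac p).tsum_eq.symm))
    (Eventually.of_forall hfac)
  refine (h.div_const (mom P 1 0)).of_eq (fun s => ?_) rfl
  rw [integral_const_mul, gInc, mul_div_assoc]

theorem gInc_nonneg {P : Measure (ℕ × ℝ)} (hP : ∀ᵐ p ∂P, p.2 ∈ Set.Icc (0 : ℝ) 1) (s : ℕ) :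
    0 ≤ gInc P s := by
  refine div_nonneg (integral_nonneg_of_ae ?_) (integral_nonneg_of_ae ?_)
  · filter_upwards [hP] with p hp
    exact mul_nonneg (Nat.cast_nonneg _) (binP_nonneg hp.1 hp.2 _ _)
  · refine Eventually.of_forall fun p => ?_
    simp

end IncrementMoments

section ConvolutionMoments

theorem conv_nonneg {f h : ℕ → ℝ} (hf : ∀ s, 0 ≤ f s) (hh : ∀ s, 0 ≤ h s) (s : ℕ) :
    0 ≤ conv f h s :=
  Finset.sum_nonneg fun i _ => mul_nonneg (hf i) (hh _)

theorem convPow_nonneg {f : ℕ → ℝ} (hf : ∀ s, 0 ≤ f s) (j s : ℕ) : 0 ≤ convPow f j s := by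
  induction j generalizing s with
  | zero => simp only [convPow]; split <;> norm_num
  | succ j ih => exact conv_nonneg hf ih s

theorem hasSum_conv {f h : ℕ → ℝ} {a b : ℝ} (hf0 : ∀ s, 0 ≤ f s) (hh0 : ∀ s, 0 ≤ h s)
    (hf : HasSum f a) (hh : HasSum h b) : HasSum (conv f h) (a * b) := by
  have hf' : Summable fun s => ‖f s‖ := hf.summable.congr fun s => by
    rw [Real.norm_of_nonneg (hf0 s)]
  have hh' : Summable fun s => ‖h s‖ := hh.summable.congr fun s => by
    rw [Real.norm_of_nonneg (hh0 s)]
  rw [← hf.tsum_eq, ← hh.tsum_eq, tsum_mul_tsum_eq_tsum_sum_range_of_summable_norm hf' hh']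
  exact (summable_norm_sum_mul_range_of_summable_norm hf' hh').of_norm.hasSum

/-- Moments up to order three of the convolution power of a mass function. -/
theorem hasSum_moments_convPow {f : ℕ → ℝ} {a₁ a₂ a₃ : ℝ} (hf : ∀ s, 0 ≤ f s)
    (h₀ : HasSum f 1) (h₁ : HasSum (fun s : ℕ => (s : ℝ) * f s) a₁)
    (h₂ : HasSum (fun s : ℕ => (s : ℝ) ^ 2 * f s) a₂)
    (h₃ : HasSum (fun s : ℕ => (s : ℝ) ^ 3 * f s) a₃) (j : ℕ) :
    HasSum (convPow f j) 1 ∧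
    HasSum (fun s : ℕ => (s : ℝ) * convPow f j s) (j * a₁) ∧
    HasSum (fun s : ℕ => (s : ℝ) ^ 2 * convPow f j s) (j * a₂ + j * (j - 1) * a₁ ^ 2) ∧
    HasSum (fun s : ℕ => (s : ℝ) ^ 3 * convPow f j s)
      (j * a₃ + 3 * (j * (j - 1)) * (a₁ * a₂) + j * (j - 1) * (j - 2) * a₁ ^ 3) := by
  induction j with
  | zero =>
    have hz : ∀ r : ℕ, r ≠ 0 → (fun s : ℕ => (s : ℝ) ^ r * convPow f 0 s) = fun _ => 0 := by
      intro r hr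
      ext s
      simp only [convPow]
      split_ifs with h <;> simp [h, hr]
    have h1 := hz 1 one_ne_zero
    simp only [pow_one] at h1
    rw [h1, hz 2 two_ne_zero, hz 3 three_ne_zero]
    refine ⟨?_, by simp, by simp, by simp⟩
    exact hasSum_ite_eq 0 1
  | succ j ih =>
    obtain ⟨i₀, i₁, i₂, i₃⟩ := ih
    have hc := convPow_nonneg hf j
    have pf : ∀ r : ℕ, ∀ s : ℕ, 0 ≤ (s : ℝ) ^ r * f s := fun r s =>
      mul_nonneg (by positivity) (hf s)
    have pc : ∀ r : ℕ, ∀ s : ℕ, 0 ≤ (s : ℝ) ^ r * convPow f j s :=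
      fun r s => mul_nonneg (by positivity) (hc s)
    have pf1 : ∀ s : ℕ, 0 ≤ (s : ℝ) * f s := fun s => mul_nonneg (by positivity) (hf s)
    have pc1 : ∀ s : ℕ, 0 ≤ (s : ℝ) * convPow f j s := fun s => mul_nonneg (by positivity) (hc s)
    have hsub : ∀ s i : ℕ, i ∈ Finset.range (s + 1) → (s : ℝ) = i + (s - i : ℕ) := by
      intro s i hi
      have : i ≤ s := by simp at hi; omega
      push_cast [Nat.cast_sub this]; ring
    refine ⟨?_, ?_, ?_, ?_⟩
    · simpa [convPow] using hasSum_conv hf hc h₀ i₀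
    · have := (hasSum_conv pf1 hc h₁ i₀).add (hasSum_conv hf pc1 h₀ i₁)
      convert this using 1
      · ext s
        simp only [convPow, conv, Finset.mul_sum, ← Finset.sum_add_distrib]
        refine Finset.sum_congr rfl fun i hi => ?_
        rw [hsub s i hi]; ring
      · push_cast; ring
    · have := ((hasSum_conv (pf 2) hc h₂ i₀).add (hasSum_conv hf (pc 2) h₀ i₂)).add
        ((hasSum_conv pf1 pc1 h₁ i₁).mul_left 2)
      convert this using 1
      · ext s
        simp only [convPow, conv, Finset.mul_sum, ← Finset.sum_add_distrib]
        refine Finset.sum_congr rfl fun i hi => ?_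
        rw [hsub s i hi]; ring
      · push_cast; ring
    · have := ((hasSum_conv (pf 3) hc h₃ i₀).add (hasSum_conv hf (pc 3) h₀ i₃)).add
        (((hasSum_conv (pf 2) pc1 h₂ i₁).mul_left 3).add
          ((hasSum_conv pf1 (pc 2) h₁ i₂).mul_left 3))
      convert this using 1
      · ext s
        simp only [convPow, conv, Finset.mul_sum, ← Finset.sum_add_distrib]
        refine Finset.sum_congr rfl fun i hi => ?_
        rw [hsub s i hi]; ring
      · push_cast; ring

/-- Factorial moments of the Poisson distribution. -/
theorem hasSum_poisson_descFactorial (lam : ℝ) (r : ℕ) :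
    HasSum (fun j : ℕ => Real.exp (-lam) * lam ^ j / (j.factorial : ℝ) * (j.descFactorial r : ℝ))
      (lam ^ r) := by
  have hexp : HasSum (fun j : ℕ => lam ^ j / (j.factorial : ℝ)) (Real.exp lam) := by
    rw [Real.exp_eq_exp_ℝ]; exact NormedSpace.expSeries_div_hasSum_exp lam
  have h := (hexp.mul_left (Real.exp (-lam) * lam ^ r))
  rw [mul_right_comm, ← Real.exp_add, neg_add_cancel, Real.exp_zero, one_mul] at h
  rw [← hasSum_nat_add_iff' r, Finset.sum_eq_zero, sub_zero]
  · refine h.of_eq (fun j => ?_) rfl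
    have hf : ((j + r).factorial : ℝ) = j.factorial * (j + r).descFactorial r := by
      have := Nat.factorial_mul_descFactorial (Nat.le_add_left r j)
      rw [Nat.add_sub_cancel] at this
      exact_mod_cast this.symm
    have h1 : (j.factorial : ℝ) ≠ 0 := by positivity
    have h2 : ((j + r).descFactorial r : ℝ) ≠ 0 := by
      have : 0 < (j + r).descFactorial r := Nat.descFactorial_pos.2 (Nat.le_add_left r j)
      positivity
    rw [hf, pow_add]
    field_simp
  · intro j hj
    rw [Nat.descFactorial_of_lt (by simpa using hj)]
    simp

theorem hasSum_third_moment_cpoi {lam : ℝ} (hlam : 0 ≤ lam) {f : ℕ → ℝ} {a₁ a₂ a₃ : ℝ}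
    (hf : ∀ s, 0 ≤ f s) (h₀ : HasSum f 1) (h₁ : HasSum (fun s : ℕ => (s : ℝ) * f s) a₁)
    (h₂ : HasSum (fun s : ℕ => (s : ℝ) ^ 2 * f s) a₂)
    (h₃ : HasSum (fun s : ℕ => (s : ℝ) ^ 3 * f s) a₃) :
    HasSum (fun s : ℕ => (s : ℝ) ^ 3 * cpoi lam f s)
      (lam * a₃ + 3 * lam ^ 2 * (a₁ * a₂) + lam ^ 3 * a₁ ^ 3) := by
  set w : ℕ → ℝ := fun j => Real.exp (-lam) * lam ^ j / (j.factorial : ℝ) with hw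
  have hw0 : ∀ j, 0 ≤ w j := fun j => by positivity
  set F : ℕ × ℕ → ℝ := fun p => w p.1 * ((p.2 : ℝ) ^ 3 * convPow f p.1 p.2) with hF
  have hF0 : 0 ≤ F := fun p =>
    mul_nonneg (hw0 _) (mul_nonneg (by positivity) (convPow_nonneg hf _ _))
  have hrow : ∀ j, HasSum (fun s => F (j, s)) (w j *
      (j * a₃ + 3 * (j * (j - 1)) * (a₁ * a₂) + j * (j - 1) * (j - 2) * a₁ ^ 3)) := fun j =>
    ((hasSum_moments_convPow hf h₀ h₁ h₂ h₃ j).2.2.2).mul_left _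
  have htot : HasSum (fun j : ℕ => w j *
      (j * a₃ + 3 * (j * (j - 1)) * (a₁ * a₂) + j * (j - 1) * (j - 2) * a₁ ^ 3))
      (lam * a₃ + 3 * lam ^ 2 * (a₁ * a₂) + lam ^ 3 * a₁ ^ 3) := by
    have := (((hasSum_poisson_descFactorial lam 1).mul_right a₃).add
      ((hasSum_poisson_descFactorial lam 2).mul_right (3 * (a₁ * a₂)))).add
      ((hasSum_poisson_descFactorial lam 3).mul_right (a₁ ^ 3))
    refine this.of_eq (fun j => ?_) (by ring)
    · rw [Nat.cast_descFactorial_two, Nat.descFactorial_one]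
      have h3 : (j.descFactorial 3 : ℝ) = j * (j - 1) * (j - 2) := by
        rcases j with _ | _ | j
        · simp
        · simp
        · simp [Nat.descFactorial_succ]; ring
      rw [h3]; ring
  have hsum : Summable F := by
    rw [summable_prod_of_nonneg hF0]
    exact ⟨fun j => (hrow j).summable, htot.summable.congr fun j => (hrow j).tsum_eq.symm⟩
  have hFs : HasSum F (lam * a₃ + 3 * lam ^ 2 * (a₁ * a₂) + lam ^ 3 * a₁ ^ 3) := by
    have := hsum.hasSum.prod_fiberwise hrow
    rw [← this.unique htot]
    exact hsum.hasSum
  have hswap := (Equiv.prodComm ℕ ℕ).hasSum_iff.mpr hFs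
  have := hswap.prod_fiberwise fun s => (hswap.summable.prod_factor s).hasSum
  refine this.of_eq (fun s => ?_) rfl
  simp only [cpoi, hF, Function.comp, Equiv.prodComm_apply, Prod.swap, ← tsum_mul_left]
  refine tsum_congr fun j => ?_
  simp only [hw]; ring

end ConvolutionMoments

section LayerMeasure

set_option linter.deprecated false in
theorem bern_singleton (y : ℝ) (b : Bool) :
    bern y {b} = cond b (min (Real.toNNReal y) 1 : NNReal)
      (1 - min (Real.toNNReal y) 1 : NNReal) := by
  rw [bern, PMF.toMeasure_apply_singleton _ _ (measurableSet_singleton _)]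
  cases b <;> simp [PMF.bernoulli_apply]

theorem measurable_bern_singleton (b : Bool) : Measurable fun y : ℝ => bern y {b} := by
  simp only [bern_singleton]
  have h : Measurable fun y : ℝ => min (Real.toNNReal y) 1 := by fun_prop
  cases b
  · exact (measurable_const.sub h).coe_nnreal_ennreal
  · exact h.coe_nnreal_ennreal

theorem measurable_edgeMeasure_singleton {n : ℕ} (V : Finset (Fin n))
    (f : Sym2 (Fin n) → Bool) : Measurable fun y : ℝ => edgeMeasure n V y {f} := by
  have h : ∀ y : ℝ, edgeMeasure n V y {f} = ∏ e, edgeFactor n V y e {f e} := by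
    intro y
    rw [edgeMeasure, ← Set.univ_pi_singleton, Measure.pi_pi]
  simp only [h]
  refine Finset.measurable_fun_prod _ fun e _ => ?_
  unfold edgeFactor
  split_ifs
  · exact measurable_bern_singleton _
  · exact measurable_const

theorem bind_vertexMeasure_apply {n : ℕ} (xy : ℕ × ℝ) {s : Set (Layer n)} (hs : MeasurableSet s) :
    ((vertexMeasure n xy.1).bind fun V => (edgeMeasure n V xy.2).map fun f => (xy, V, f)) s =
      ∑ V, edgeMeasure n V xy.2 {f | (xy, V, f) ∈ s} * vertexMeasure n xy.1 {V} := by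
  rw [Measure.bind_apply hs (Measurable.of_discrete).aemeasurable, lintegral_fintype]
  refine Finset.sum_congr rfl fun V _ => ?_
  rw [Measure.map_apply (by fun_prop) hs]
  rfl

theorem measurable_bind_vertexMeasure (n : ℕ) :
    Measurable fun xy : ℕ × ℝ =>
      (vertexMeasure n xy.1).bind fun V =>
        (edgeMeasure n V xy.2).map fun f => ((xy, V, f) : Layer n) := by
  refine Measure.measurable_of_measurable_coe _ fun s hs => ?_
  simp only [bind_vertexMeasure_apply _ hs]
  refine Finset.measurable_fun_sum _ fun V _ => ?_
  refine Measurable.mul ?_ ((Measurable.of_discrete (f := fun x : ℕ => vertexMeasure n x {V})).comp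
    measurable_fst)
  have h : ∀ xy : ℕ × ℝ, edgeMeasure n V xy.2 {f | (xy, V, f) ∈ s} =
      ∑ f, Set.indicator {xy : ℕ × ℝ | (xy, V, f) ∈ s} 1 xy * edgeMeasure n V xy.2 {f} := by
    intro xy
    rw [← lintegral_indicator_one (MeasurableSet.of_discrete), lintegral_fintype]
    rfl
  simp only [h]
  refine Finset.measurable_fun_sum _ fun f _ => ?_
  refine Measurable.mul (measurable_one.indicator ?_)
    ((measurable_edgeMeasure_singleton V f).comp measurable_snd)
  exact (by fun_prop : Measurable fun xy : ℕ × ℝ => ((xy, V, f) : Layer n)) hs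

theorem layerMeasure_apply {n : ℕ} (Q : Measure (ℕ × ℝ)) {s : Set (Layer n)}
    (hs : MeasurableSet s) :
    layerMeasure n Q s = ∫⁻ xy, ∑ V,
      edgeMeasure n V xy.2 {f | (xy, V, f) ∈ s} * vertexMeasure n xy.1 {V} ∂Q := by
  rw [layerMeasure, Measure.bind_apply hs (measurable_bind_vertexMeasure n).aemeasurable]
  exact lintegral_congr fun xy => bind_vertexMeasure_apply xy hs

instance (n : ℕ) (Q : Measure (ℕ × ℝ)) [IsProbabilityMeasure Q] :
    IsProbabilityMeasure (layerMeasure n Q) := by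
  refine ⟨?_⟩
  rw [layerMeasure_apply Q MeasurableSet.univ]
  simp

/-- The set of neighbours of the node `z` in a layer. -/
def layerNbrs {n : ℕ} (z : Fin n) (L : Layer n) : Finset (Fin n) :=
  Finset.univ.filter fun v => s(z, v) ∈ layerEdges L

theorem mem_layerNbrs {n : ℕ} {z v : Fin n} {L : Layer n} :
    v ∈ layerNbrs z L ↔ L.2.2 s(z, v) = true ∧ z ≠ v ∧ z ∈ L.2.1 ∧ v ∈ L.2.1 := by
  simp [layerNbrs, layerEdges]

theorem measurable_layerNbrs {n : ℕ} (z : Fin n) : Measurable (layerNbrs z) := by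
  have : layerNbrs z = (fun p : Finset (Fin n) × (Sym2 (Fin n) → Bool) =>
      layerNbrs z (((0, 0), p) : Layer n)) ∘ fun L => L.2 := by
    ext L v
    simp [mem_layerNbrs]
  rw [this]
  exact Measurable.of_discrete.comp measurable_snd

/-- The probability that a uniformly random set of `x` nodes contains a given set. -/
theorem vertexMeasure_superset {n x : ℕ} (hx : x ≤ n) (B : Finset (Fin n)) :
    vertexMeasure n x {V | B ⊆ V} =
      ENNReal.ofReal (x.descFactorial B.card / n.descFactorial B.card) := by
  have hne : (Finset.powersetCard x (Finset.univ : Finset (Fin n))).Nonempty :=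
    Finset.powersetCard_nonempty.2 (by simpa using hx)
  have hB : B.card ≤ n := by simpa using B.card_le_univ
  rw [vertexMeasure, dif_pos hne, PMF.toMeasure_uniformOfFinset_apply _ _ MeasurableSet.of_discrete]
  simp only [Set.mem_ofPred_eq]
  have hnx : 0 < n.choose x := Nat.choose_pos hx
  have hnB : 0 < n.descFactorial B.card := Nat.descFactorial_pos.2 hB
  rcases lt_or_ge x B.card with h | h
  · rw [Nat.descFactorial_of_lt h, Finset.card_eq_zero.2]
    · simp
    · refine Finset.filter_eq_empty_iff.2 fun V hV hBV => ?_
      have := Finset.card_le_card hBV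
      rw [(Finset.mem_powersetCard.1 hV).2] at this
      omega
  · rw [Finset.card_filter_powersetCard_subset B _ x (Finset.subset_univ _) h,
      Finset.card_powersetCard, Finset.card_univ, Fintype.card_fin,
      ← ENNReal.ofReal_natCast, ← ENNReal.ofReal_natCast,
      ← ENNReal.ofReal_div_of_pos (by positivity)]
    congr 1
    rw [div_eq_div_iff (by positivity) (by positivity),
      Nat.descFactorial_eq_factorial_mul_choose, Nat.descFactorial_eq_factorial_mul_choose]
    have := Nat.choose_mul (n := n) h
    have h' : (n.choose x : ℝ) * x.choose B.card =
        n.choose B.card * (n - B.card).choose (x - B.card) := by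
      exact_mod_cast this
    push_cast
    linear_combination -(B.card.factorial : ℝ) * h'

/-- The probability that all pairs joining `z` to a set of nodes `A` are present, given the node
set of the layer. -/
theorem edgeMeasure_star {n : ℕ} {V A : Finset (Fin n)} {z : Fin n} (hz : z ∉ A)
    (hV : insert z A ⊆ V) {y : ℝ} (hy : y ∈ Set.Icc (0 : ℝ) 1) :
    edgeMeasure n V y {f | ∀ v ∈ A, f s(z, v) = true} = ENNReal.ofReal (y ^ A.card) := by
  have hset : {f : Sym2 (Fin n) → Bool | ∀ v ∈ A, f s(z, v) = true} =
      Set.univ.pi fun e => if e ∈ A.image (fun v => s(z, v)) then {true} else Set.univ := by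
    ext f
    simp only [Set.mem_ofPred_eq, Set.mem_pi, Set.mem_univ, true_imp_iff]
    constructor
    · intro h e
      split_ifs with he
      · obtain ⟨v, hv, rfl⟩ := Finset.mem_image.1 he
        exact h v hv
      · trivial
    · intro h v hv
      have := h s(z, v)
      rwa [if_pos (Finset.mem_image_of_mem _ hv)] at this
  have hfac : ∀ e, edgeFactor n V y e
      (if e ∈ A.image (fun v => s(z, v)) then {true} else Set.univ) =
      if e ∈ A.image (fun v => s(z, v)) then ENNReal.ofReal y else 1 := by
    intro e
    split_ifs with he
    · obtain ⟨v, hv, rfl⟩ := Finset.mem_image.1 he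
      rw [edgeFactor, if_pos, bern_singleton]
      · rw [min_eq_left (by simpa using hy.2)]
        rfl
      · refine ⟨fun h => hz ?_, fun w hw => hV ?_⟩
        · rw [Sym2.mk_isDiag_iff] at h
          rwa [h]
        · rcases Sym2.mem_iff.1 hw with rfl | rfl
          · exact Finset.mem_insert_self _ _
          · exact Finset.mem_insert_of_mem hv
    · exact measure_univ
  rw [edgeMeasure, hset, Measure.pi_pi, Finset.prod_congr rfl fun e _ => hfac e,
    Finset.prod_ite_mem, Finset.univ_inter, Finset.prod_const, ENNReal.ofReal_pow hy.1,
    Finset.card_image_of_injective]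
  exact fun v w h => Sym2.congr_right.1 h

/-- The probability that all nodes of `A` are neighbours of `z` in a layer. -/
theorem layerMeasure_star {n : ℕ} (Q : Measure (ℕ × ℝ)) [IsProbabilityMeasure Q]
    (hQ : ∀ᵐ p ∂Q, p.1 ≤ n ∧ p.2 ∈ Set.Icc (0 : ℝ) 1) {A : Finset (Fin n)} (hA : A.Nonempty)
    {z : Fin n} (hz : z ∉ A) :
    (layerMeasure n Q).real {L | A ⊆ layerNbrs z L} =
      mom Q (A.card + 1) A.card / n.descFactorial (A.card + 1) := by
  have hmeas : MeasurableSet {L : Layer n | A ⊆ layerNbrs z L} :=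
    measurable_layerNbrs z (MeasurableSet.of_discrete (s := {N | A ⊆ N}))
  rw [measureReal_def, layerMeasure_apply Q hmeas]
  have hpt : ∀ᵐ p ∂Q, ∑ V, edgeMeasure n V p.2
      {f | ((p, V, f) : Layer n) ∈ {L : Layer n | A ⊆ layerNbrs z L}} * vertexMeasure n p.1 {V} =
      ENNReal.ofReal ((p.1.descFactorial (A.card + 1) : ℝ) * p.2 ^ A.card /
        n.descFactorial (A.card + 1)) := by
    filter_upwards [hQ] with p hp
    have hterm : ∀ V, edgeMeasure n V p.2
        {f | ((p, V, f) : Layer n) ∈ {L : Layer n | A ⊆ layerNbrs z L}} =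
        ENNReal.ofReal (p.2 ^ A.card) * Set.indicator {V | insert z A ⊆ V} 1 V := by
      intro V
      by_cases hV : insert z A ⊆ V
      · rw [Set.indicator_of_mem (by exact hV), Pi.one_apply, mul_one, ← edgeMeasure_star hz hV hp.2]
        congr 1
        ext f
        simp only [Set.mem_ofPred_eq, Finset.subset_iff, mem_layerNbrs]
        refine forall₂_congr fun v hv => ?_
        have h1 : z ∈ V := hV (Finset.mem_insert_self _ _)
        have h2 : v ∈ V := hV (Finset.mem_insert_of_mem hv)
        have h3 : z ≠ v := fun h => hz (h ▸ hv)
        simp [h1, h2, h3]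
      · rw [Set.indicator_of_notMem (by exact hV), mul_zero]
        convert measure_empty
        · ext f
          simp only [Set.mem_ofPred_eq, Set.mem_empty_iff_false, iff_false]
          intro h
          apply hV
          obtain ⟨a, ha⟩ := hA
          refine Finset.insert_subset (mem_layerNbrs.1 (h ha)).2.2.1 fun v hv => ?_
          exact (mem_layerNbrs.1 (h hv)).2.2.2
        · infer_instance
    refine (Finset.sum_congr rfl fun V _ => congrArg (· * _) (hterm V)).trans ?_
    simp only [mul_assoc]
    rw [← Finset.mul_sum, ← lintegral_fintype, lintegral_indicator_one MeasurableSet.of_discrete,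
      vertexMeasure_superset hp.1, Finset.card_insert_of_notMem hz,
      ← ENNReal.ofReal_mul (pow_nonneg hp.2.1 _)]
    congr 1
    ring
  rw [lintegral_congr_ae hpt, ← integral_eq_lintegral_of_nonneg_ae, integral_div, mom]
  · filter_upwards [hQ] with p hp
    have := hp.2.1
    exact div_nonneg (mul_nonneg (by positivity) (pow_nonneg this _)) (by positivity)
  · refine Measurable.aestronglyMeasurable ?_
    have : Measurable fun x : ℕ => (x.descFactorial (A.card + 1) : ℝ) := Measurable.of_discrete
    exact ((this.comp measurable_fst).mul (measurable_snd.pow_const _)).div_const _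

end LayerMeasure

section LayerMoments

/-- The distribution of the set of neighbours of `z` in a single layer. -/
def nbrMeasure {n : ℕ} (z : Fin n) (Q : Measure (ℕ × ℝ)) : Measure (Finset (Fin n)) :=
  (layerMeasure n Q).map (layerNbrs z)

instance {n : ℕ} (z : Fin n) (Q : Measure (ℕ × ℝ)) [IsProbabilityMeasure Q] :
    IsProbabilityMeasure (nbrMeasure z Q) :=
  Measure.isProbabilityMeasure_map (measurable_layerNbrs z).aemeasurable

variable {n : ℕ} (z : Fin n) (Q : Measure (ℕ × ℝ)) [IsProbabilityMeasure Q]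
  (hQ : ∀ᵐ p ∂Q, p.1 ≤ n ∧ p.2 ∈ Set.Icc (0 : ℝ) 1)

omit [IsProbabilityMeasure Q] in
theorem nbrMeasure_self : ∀ᵐ N ∂nbrMeasure z Q, z ∉ N := by
  rw [nbrMeasure, ae_map_iff (measurable_layerNbrs z).aemeasurable MeasurableSet.of_discrete]
  exact Eventually.of_forall fun L h => (mem_layerNbrs.1 h).2.1 rfl

include hQ in
theorem nbrMeasure_superset {A : Finset (Fin n)} (hA : A.Nonempty) (hz : z ∉ A) :
    (nbrMeasure z Q).real {N | A ⊆ N} =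
      mom Q (A.card + 1) A.card / n.descFactorial (A.card + 1) := by
  rw [nbrMeasure, map_measureReal_apply (measurable_layerNbrs z) MeasurableSet.of_discrete]
  exact layerMeasure_star Q hQ hA hz

include hQ in
theorem nbrMeasure_mem_le (v : Fin n) :
    (nbrMeasure z Q).real {N | v ∈ N} ≤ mom Q 2 1 / (n * (n - 1)) := by
  by_cases hv : v = z
  · have : (nbrMeasure z Q).real {N | v ∈ N} = 0 := by
      rw [measureReal_eq_zero_iff, hv]
      simpa [ae_iff] using nbrMeasure_self z Q
    rw [this]
    refine div_nonneg (integral_nonneg_of_ae ?_) ?_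
    · filter_upwards [hQ] with p hp
      exact mul_nonneg (Nat.cast_nonneg _) (pow_nonneg hp.2.1 _)
    · rw [← Nat.cast_descFactorial_two]
      positivity
  · have h := nbrMeasure_superset z Q hQ (Finset.singleton_nonempty v)
      (by simpa [eq_comm] using hv)
    simp only [Finset.singleton_subset_iff, Finset.card_singleton, Nat.reduceAdd,
      Nat.cast_descFactorial_two] at h
    exact h.le

include hQ in
theorem integral_descFactorial_card_nbrMeasure {r : ℕ} (hr : r ≠ 0) (hrn : r + 1 ≤ n) :
    ∫ N, (N.card.descFactorial r : ℝ) ∂nbrMeasure z Q = mom Q (r + 1) r / n := by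
  have hpt : ∀ᵐ N ∂nbrMeasure z Q, (N.card.descFactorial r : ℝ) =
      r.factorial * ∑ A ∈ (Finset.univ.erase z).powersetCard r,
        Set.indicator {N | A ⊆ N} (fun _ => (1 : ℝ)) N := by
    filter_upwards [nbrMeasure_self z Q] with N hN
    rw [Nat.descFactorial_eq_factorial_mul_choose, ← Finset.card_powersetCard]
    push_cast
    congr 1
    simp only [Set.indicator_apply, Set.mem_ofPred_eq]
    rw [← Finset.sum_filter, Finset.sum_const, nsmul_one]
    congr 2
    ext A
    simp only [Finset.mem_powersetCard, Finset.mem_filter, Finset.subset_erase,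
      Finset.subset_univ, true_and]
    exact ⟨fun h => ⟨⟨fun hz => hN (h.1 hz), h.2⟩, h.1⟩, fun h => ⟨h.2, h.1.2⟩⟩
  rw [integral_congr_ae hpt, integral_const_mul, integral_finsetSum _ fun _ _ => .of_finite]
  have hterm : ∀ A ∈ (Finset.univ.erase z).powersetCard r,
      ∫ N, Set.indicator {N | A ⊆ N} (fun _ => (1 : ℝ)) N ∂nbrMeasure z Q =
        mom Q (r + 1) r / n.descFactorial (r + 1) := by
    intro A hA
    obtain ⟨hA', rfl⟩ := Finset.mem_powersetCard.1 hA
    rw [integral_indicator_const _ MeasurableSet.of_discrete, smul_eq_mul, mul_one]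
    exact nbrMeasure_superset z Q hQ (Finset.card_ne_zero.1 hr) (Finset.subset_erase.1 hA').2
  rw [Finset.sum_congr rfl hterm, Finset.sum_const, Finset.card_powersetCard,
    Finset.card_erase_of_mem (Finset.mem_univ z), Finset.card_univ, Fintype.card_fin]
  obtain ⟨k, rfl⟩ : ∃ k, n = k + 1 := ⟨n - 1, by omega⟩
  have hk : (k.descFactorial r : ℝ) ≠ 0 := by
    have : 0 < k.descFactorial r := Nat.descFactorial_pos.2 (by omega)
    positivity
  have h2 : (k.descFactorial r : ℝ) = r.factorial * k.choose r := by
    exact_mod_cast Nat.descFactorial_eq_factorial_mul_choose k r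
  rw [Nat.succ_descFactorial_succ, Nat.add_sub_cancel, nsmul_eq_mul, ← mul_assoc, ← h2]
  push_cast
  field_simp

theorem cast_pow_three_eq_descFactorial (k : ℕ) :
    (k : ℝ) ^ 3 = k.descFactorial 3 + 3 * k.descFactorial 2 + k.descFactorial 1 := by
  rcases k with _ | _ | k
  · simp
  · simp
  · simp [Nat.descFactorial_succ]; ring

theorem cast_pow_two_eq_descFactorial (k : ℕ) :
    (k : ℝ) ^ 2 = k.descFactorial 2 + k.descFactorial 1 := by
  rw [Nat.cast_descFactorial_two, Nat.descFactorial_one]; ring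

include hQ in
theorem integral_card_nbrMeasure (hn : 4 ≤ n) :
    ∫ N, (N.card : ℝ) ∂nbrMeasure z Q = mom Q 2 1 / n := by
  simpa using integral_descFactorial_card_nbrMeasure z Q hQ (r := 1) (by simp) (by omega)

include hQ in
theorem integral_card_sq_nbrMeasure (hn : 4 ≤ n) :
    ∫ N, (N.card : ℝ) ^ 2 ∂nbrMeasure z Q = (mom Q 3 2 + mom Q 2 1) / n := by
  simp only [cast_pow_two_eq_descFactorial]
  rw [integral_add .of_finite .of_finite,
    integral_descFactorial_card_nbrMeasure z Q hQ (by simp) (by omega),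
    integral_descFactorial_card_nbrMeasure z Q hQ (by simp) (by omega), add_div]

include hQ in
theorem integral_card_cube_nbrMeasure (hn : 4 ≤ n) :
    ∫ N, (N.card : ℝ) ^ 3 ∂nbrMeasure z Q = (mom Q 4 3 + 3 * mom Q 3 2 + mom Q 2 1) / n := by
  simp only [cast_pow_three_eq_descFactorial]
  rw [integral_add .of_finite .of_finite, integral_add .of_finite .of_finite, integral_const_mul,
    integral_descFactorial_card_nbrMeasure z Q hQ (by simp) (by omega),
    integral_descFactorial_card_nbrMeasure z Q hQ (by simp) (by omega),
    integral_descFactorial_card_nbrMeasure z Q hQ (by simp) (by omega)]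
  ring

end LayerMoments

section TotalCard

variable {ι V : Type*}

/-- The total number of elements, with multiplicity, of the sets indexed by `s`. -/
def totalCard (s : Finset ι) (ω : ι → Finset V) : ℝ := ∑ k ∈ s, ((ω k).card : ℝ)

theorem totalCard_nonneg (s : Finset ι) (ω : ι → Finset V) : 0 ≤ totalCard s ω :=
  Finset.sum_nonneg fun _ _ => Nat.cast_nonneg _

theorem dependsOn_totalCard (s : Finset ι) :
    DependsOn (totalCard s : (ι → Finset V) → ℝ) (s : Set ι) := by
  intro ω ω' h
  exact Finset.sum_congr rfl fun k hk => by rw [h k hk]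

theorem totalCard_mono {s t : Finset ι} (h : s ⊆ t) (ω : ι → Finset V) :
    totalCard s ω ≤ totalCard t ω :=
  Finset.sum_le_sum_of_subset_of_nonneg h fun _ _ _ => Nat.cast_nonneg _

variable [DecidableEq ι]

theorem totalCard_insert {s : Finset ι} {k : ι} (hk : k ∉ s) (ω : ι → Finset V) :
    totalCard (insert k s) ω = (ω k).card + totalCard s ω :=
  Finset.sum_insert hk

variable [DecidableEq V]

omit [DecidableEq ι] in
theorem card_biUnion_le_totalCard (s : Finset ι) (ω : ι → Finset V) :
    ((s.biUnion ω).card : ℝ) ≤ totalCard s ω := by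
  have := Finset.card_biUnion_le (s := s) (t := ω)
  unfold totalCard
  exact_mod_cast this

theorem totalCard_sub_card_biUnion_le (s : Finset ι) (ω : ι → Finset V) :
    totalCard s ω - (s.biUnion ω).card ≤
      ∑ k ∈ s, ((ω k ∩ (s.erase k).biUnion ω).card : ℝ) := by
  induction s using Finset.induction_on with
  | empty => simp [totalCard]
  | insert k s hk ih =>
    have h := Finset.card_union_add_card_inter (ω k) (s.biUnion ω)
    have h' : (((ω k ∪ s.biUnion ω).card : ℕ) : ℝ) + (ω k ∩ s.biUnion ω).card =
      (ω k).card + (s.biUnion ω).card := by exact_mod_cast h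
    rw [totalCard_insert hk, Finset.biUnion_insert, Finset.sum_insert hk,
      Finset.erase_insert hk]
    have hmono : ∑ l ∈ s, ((ω l ∩ (s.erase l).biUnion ω).card : ℝ) ≤
        ∑ l ∈ s, ((ω l ∩ ((insert k s).erase l).biUnion ω).card : ℝ) := by
      refine Finset.sum_le_sum fun l _ => ?_
      gcongr
      exact Finset.subset_insert k s
    linarith

theorem card_inter_eq_sum_indicator [Fintype V] (A B : Finset V) :
    ((A ∩ B).card : ℝ) = ∑ v, (if v ∈ A then 1 else 0) * (if v ∈ B then 1 else 0) := by
  simp [← ite_and, ← Finset.mem_inter, Finset.inter_comm]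

end TotalCard

section UnionOfRandomSets

variable {ι V : Type*} [Fintype ι] [Fintype V] [MeasurableSpace (Finset V)]
  [DiscreteMeasurableSpace (Finset V)] [DecidableEq ι] [DecidableEq V]
  (ν : Measure (Finset V)) [IsProbabilityMeasure ν]

omit [DecidableEq V] in
theorem integral_mul_of_dependsOn {k : ι} {s : Finset ι} (hk : k ∉ s) (F : Finset V → ℝ)
    {G : (ι → Finset V) → ℝ} (hG : DependsOn G (s : Set ι)) :
    ∫ ω, F (ω k) * G ω ∂Measure.pi (fun _ : ι => ν) =
      (∫ N, F N ∂ν) * ∫ ω, G ω ∂Measure.pi (fun _ : ι => ν) := by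
  have hind : iIndepFun (fun (i : ι) (ω : ι → Finset V) => ω i) (Measure.pi fun _ : ι => ν) :=
    iIndepFun_pi (X := fun _ N => N) fun _ => aemeasurable_id
  have h := hind.indepFun_finset {k} s (by simpa using hk) fun i => measurable_pi_apply i
  have hGω : ∀ ω : ι → Finset V, (G fun i => if _h : i ∈ s then ω i else ∅) = G ω := fun ω =>
    hG fun i hi => dif_pos hi
  have h2 := h.comp
    (φ := fun a => F (a ⟨k, Finset.mem_singleton_self k⟩))
    (ψ := fun b => G fun i => if hi : i ∈ s then b ⟨i, hi⟩ else ∅)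
    Measurable.of_discrete Measurable.of_discrete
  have h3 := h2.integral_fun_mul_eq_mul_integral
    (Measurable.of_discrete.aestronglyMeasurable) (Measurable.of_discrete.aestronglyMeasurable)
  simp only [Function.comp_def, hGω] at h3
  have h4 : ∫ ω, F (ω k) ∂Measure.pi (fun _ : ι => ν) = ∫ N, F N ∂ν := by
    rw [← integral_map (φ := Function.eval k) (measurable_pi_apply k).aemeasurable
      Measurable.of_discrete.aestronglyMeasurable,
      (measurePreserving_eval (fun _ : ι => ν) k).map_eq]
  rw [← h4]
  exact h3

omit [DecidableEq V] in
theorem integral_coordinate (k : ι) (F : Finset V → ℝ) :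
    ∫ ω, F (ω k) ∂Measure.pi (fun _ : ι => ν) = ∫ N, F N ∂ν := by
  simpa using integral_mul_of_dependsOn ν (Finset.notMem_empty k) F
    (G := fun _ => 1) (fun _ _ _ => rfl)

omit [DecidableEq V] in
/-- Moments up to order three of the total cardinality of independent random sets. -/
theorem integral_totalCard_moments {a₁ a₂ a₃ : ℝ} (h₁ : ∫ N, (N.card : ℝ) ∂ν = a₁)
    (h₂ : ∫ N, (N.card : ℝ) ^ 2 ∂ν = a₂) (h₃ : ∫ N, (N.card : ℝ) ^ 3 ∂ν = a₃) (s : Finset ι) :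
    ∫ ω, totalCard s ω ∂Measure.pi (fun _ : ι => ν) = s.card * a₁ ∧
    ∫ ω, totalCard s ω ^ 2 ∂Measure.pi (fun _ : ι => ν) =
      s.card * a₂ + s.card * (s.card - 1) * a₁ ^ 2 ∧
    ∫ ω, totalCard s ω ^ 3 ∂Measure.pi (fun _ : ι => ν) =
      s.card * a₃ + 3 * (s.card * (s.card - 1)) * (a₁ * a₂) +
        s.card * (s.card - 1) * (s.card - 2) * a₁ ^ 3 := by
  induction s using Finset.induction_on with
  | empty => simp [totalCard]
  | insert k s hk ih =>
    obtain ⟨i₁, i₂, i₃⟩ := ih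
    have hd := dependsOn_totalCard (V := V) s
    have hd2 : DependsOn (fun ω : ι → Finset V => totalCard s ω ^ 2) (s : Set ι) :=
      fun ω ω' h => by simp only [hd h]
    have e11 := integral_mul_of_dependsOn ν hk (fun N => (N.card : ℝ)) hd
    have e12 := integral_mul_of_dependsOn ν hk (fun N => (N.card : ℝ)) hd2
    have e21 := integral_mul_of_dependsOn ν hk (fun N => (N.card : ℝ) ^ 2) hd
    have c1 := integral_coordinate ν k fun N => (N.card : ℝ)
    have c2 := integral_coordinate ν k fun N => (N.card : ℝ) ^ 2
    have c3 := integral_coordinate ν k fun N => (N.card : ℝ) ^ 3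
    simp only [h₁, h₂, h₃, i₁, i₂] at e11 e12 e21 c1 c2 c3
    simp only [totalCard_insert hk, Finset.card_insert_of_notMem hk]
    push_cast
    refine ⟨?_, ?_, ?_⟩
    · rw [integral_add .of_finite .of_finite, c1, i₁]; ring
    · have : ∀ ω : ι → Finset V, ((ω k).card + totalCard s ω) ^ 2 =
          ((ω k).card : ℝ) ^ 2 + 2 * ((ω k).card * totalCard s ω) + totalCard s ω ^ 2 :=
        fun ω => by ring
      simp only [this]
      rw [integral_add .of_finite .of_finite, integral_add .of_finite .of_finite,
        integral_const_mul, c2, e11, i₂]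
      ring
    · have : ∀ ω : ι → Finset V, ((ω k).card + totalCard s ω) ^ 3 =
          ((ω k).card : ℝ) ^ 3 + 3 * ((ω k).card ^ 2 * totalCard s ω) +
            3 * ((ω k).card * totalCard s ω ^ 2) + totalCard s ω ^ 3 :=
        fun ω => by ring
      simp only [this]
      rw [integral_add .of_finite .of_finite, integral_add .of_finite .of_finite,
        integral_add .of_finite .of_finite, integral_const_mul, integral_const_mul,
        c3, e21, e12, i₃]
      ring

variable {ν}

theorem integral_mem_biUnion_le {q : ℝ} (hq : ∀ v, ν.real {N | v ∈ N} ≤ q) (s : Finset ι)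
    (v : V) :
    ∫ ω, (if v ∈ s.biUnion ω then (1 : ℝ) else 0) ∂Measure.pi (fun _ : ι => ν) ≤ s.card * q := by
  calc ∫ ω, (if v ∈ s.biUnion ω then (1 : ℝ) else 0) ∂Measure.pi (fun _ : ι => ν)
      ≤ ∫ ω, ∑ l ∈ s, (if v ∈ ω l then (1 : ℝ) else 0) ∂Measure.pi (fun _ : ι => ν) := by
        refine integral_mono .of_finite .of_finite fun ω => ?_
        dsimp only
        split_ifs with h
        · obtain ⟨l, hl, hv⟩ := Finset.mem_biUnion.1 h
          refine le_trans ?_ (Finset.single_le_sum (fun i _ => ?_) hl)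
          · rw [if_pos hv]
          · split_ifs <;> norm_num
        · exact Finset.sum_nonneg fun i _ => by split_ifs <;> norm_num
    _ = ∑ l ∈ s, ν.real {N | v ∈ N} := by
        rw [integral_finsetSum _ fun _ _ => .of_finite]
        refine Finset.sum_congr rfl fun l _ => ?_
        rw [integral_coordinate ν l fun N => if v ∈ N then (1 : ℝ) else 0,
          ← integral_indicator_one MeasurableSet.of_discrete]
        simp [Set.indicator_apply]
    _ ≤ s.card * q := by
        rw [Finset.sum_const, nsmul_eq_mul]
        exact mul_le_mul_of_nonneg_left (hq v) (Nat.cast_nonneg _)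

/-- The overlap of one random set with the union of independent others, weighted by the squared
total cardinality. -/
theorem integral_sq_mul_card_inter_le {q : ℝ} (hq : ∀ v, ν.real {N | v ∈ N} ≤ q) (hq0 : 0 ≤ q)
    (k : ι) {s : Finset ι} (hk : k ∉ s) :
    ∫ ω, ((ω k).card + totalCard s ω) ^ 2 * ((ω k ∩ s.biUnion ω).card : ℝ)
      ∂Measure.pi (fun _ : ι => ν) ≤
      2 * (s.card * q * ∫ N, (N.card : ℝ) ^ 3 ∂ν) +
        2 * (q * ∫ ω, totalCard s ω ^ 3 ∂Measure.pi (fun _ : ι => ν)) := by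
  set M := Measure.pi (fun _ : ι => ν) with hM
  have hJ : ∀ v, DependsOn (fun ω : ι → Finset V => if v ∈ s.biUnion ω then (1 : ℝ) else 0)
      (s : Set ι) := by
    intro v ω ω' h
    have : s.biUnion ω = s.biUnion ω' := Finset.biUnion_congr rfl fun i hi => h i hi
    simp only [this]
  have hTJ : ∀ v, DependsOn (fun ω : ι → Finset V =>
      totalCard s ω ^ 2 * if v ∈ s.biUnion ω then (1 : ℝ) else 0) (s : Set ι) :=
    fun v ω ω' h => by
      have h1 := hJ v h
      have h2 := dependsOn_totalCard s h
      dsimp only at h1 ⊢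
      rw [h1, h2]
  have hI : ∀ v, ∫ N, (if v ∈ N then (1 : ℝ) else 0) ∂ν ≤ q := by
    intro v
    refine le_of_eq_of_le ?_ (hq v)
    rw [← integral_indicator_one MeasurableSet.of_discrete]
    simp [Set.indicator_apply]
  calc ∫ ω, ((ω k).card + totalCard s ω) ^ 2 * ((ω k ∩ s.biUnion ω).card : ℝ) ∂M
      ≤ ∫ ω, (2 * ∑ v, ((ω k).card ^ 2 * (if v ∈ ω k then (1 : ℝ) else 0)) *
            (if v ∈ s.biUnion ω then (1 : ℝ) else 0) +
          2 * ∑ v, (if v ∈ ω k then (1 : ℝ) else 0) *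
            (totalCard s ω ^ 2 * (if v ∈ s.biUnion ω then (1 : ℝ) else 0))) ∂M := by
        refine integral_mono .of_finite .of_finite fun ω => ?_
        have h1 : ((ω k).card + totalCard s ω) ^ 2 ≤
            2 * ((ω k).card : ℝ) ^ 2 + 2 * totalCard s ω ^ 2 := by
          nlinarith [sq_nonneg (((ω k).card : ℝ) - totalCard s ω)]
        refine (mul_le_mul_of_nonneg_right h1 (Nat.cast_nonneg _)).trans_eq ?_
        rw [card_inter_eq_sum_indicator, Finset.mul_sum, Finset.mul_sum, Finset.mul_sum,
          ← Finset.sum_add_distrib]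
        exact Finset.sum_congr rfl fun v _ => by ring
    _ = 2 * ∑ v, (∫ N, (N.card : ℝ) ^ 2 * (if v ∈ N then (1 : ℝ) else 0) ∂ν) *
            (∫ ω, (if v ∈ s.biUnion ω then (1 : ℝ) else 0) ∂M) +
          2 * ∑ v, (∫ N, (if v ∈ N then (1 : ℝ) else 0) ∂ν) *
            ∫ ω, totalCard s ω ^ 2 * (if v ∈ s.biUnion ω then (1 : ℝ) else 0) ∂M := by
        rw [integral_add .of_finite .of_finite, integral_const_mul, integral_const_mul,
          integral_finsetSum _ fun _ _ => .of_finite, integral_finsetSum _ fun _ _ => .of_finite]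
        congr 2
        · exact Finset.sum_congr rfl fun v _ => integral_mul_of_dependsOn ν hk
            (fun N => (N.card : ℝ) ^ 2 * if v ∈ N then (1 : ℝ) else 0) (hJ v)
        · exact Finset.sum_congr rfl fun v _ => integral_mul_of_dependsOn ν hk
            (fun N => if v ∈ N then (1 : ℝ) else 0) (hTJ v)
    _ ≤ 2 * ∑ v, (∫ N, (N.card : ℝ) ^ 2 * (if v ∈ N then (1 : ℝ) else 0) ∂ν) * (s.card * q) +
          2 * ∑ v, q *
            ∫ ω, totalCard s ω ^ 2 * (if v ∈ s.biUnion ω then (1 : ℝ) else 0) ∂M := by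
        refine add_le_add
          (mul_le_mul_of_nonneg_left (Finset.sum_le_sum fun v _ =>
            mul_le_mul_of_nonneg_left (integral_mem_biUnion_le hq s v) ?_) zero_le_two)
          (mul_le_mul_of_nonneg_left (Finset.sum_le_sum fun v _ =>
            mul_le_mul_of_nonneg_right (hI v) ?_) zero_le_two)
        · exact integral_nonneg fun N => mul_nonneg (sq_nonneg _) (ite_nonneg zero_le_one le_rfl)
        · exact integral_nonneg fun ω => mul_nonneg (sq_nonneg _) (ite_nonneg zero_le_one le_rfl)
    _ = 2 * (s.card * q * ∫ N, (N.card : ℝ) ^ 3 ∂ν) +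
          2 * (q * ∫ ω, totalCard s ω ^ 2 * ((s.biUnion ω).card : ℝ) ∂M) := by
        rw [← Finset.sum_mul, ← Finset.mul_sum, ← integral_finsetSum _ fun _ _ => .of_finite,
          ← integral_finsetSum _ fun _ _ => .of_finite]
        simp only [← Finset.mul_sum, Finset.sum_ite_mem, Finset.univ_inter, Finset.sum_const,
          nsmul_one, ← pow_succ]
        ring
    _ ≤ _ := by
        refine add_le_add le_rfl
          (mul_le_mul_of_nonneg_left (mul_le_mul_of_nonneg_left ?_ hq0) zero_le_two)
        refine integral_mono .of_finite .of_finite fun ω => ?_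
        rw [pow_succ (totalCard s ω) 2]
        exact mul_le_mul_of_nonneg_left (card_biUnion_le_totalCard s ω) (sq_nonneg _)

theorem integral_totalCard_cube_sub_le {q : ℝ} (hq : ∀ v, ν.real {N | v ∈ N} ≤ q) (hq0 : 0 ≤ q) :
    ∫ ω, totalCard Finset.univ ω ^ 3 ∂Measure.pi (fun _ : ι => ν) -
      ∫ ω, ((Finset.univ.biUnion ω).card : ℝ) ^ 3 ∂Measure.pi (fun _ : ι => ν) ≤
      6 * (Fintype.card ι * q) * (Fintype.card ι * ∫ N, (N.card : ℝ) ^ 3 ∂ν +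
        ∫ ω, totalCard Finset.univ ω ^ 3 ∂Measure.pi (fun _ : ι => ν)) := by
  set M := Measure.pi (fun _ : ι => ν) with hM
  set a := ∫ N, (N.card : ℝ) ^ 3 ∂ν with ha
  set T := ∫ ω, totalCard Finset.univ ω ^ 3 ∂M with hT
  have ha0 : 0 ≤ a := integral_nonneg fun N => by positivity
  calc T - ∫ ω, ((Finset.univ.biUnion ω).card : ℝ) ^ 3 ∂M
      = ∫ ω, (totalCard Finset.univ ω ^ 3 - ((Finset.univ.biUnion ω).card : ℝ) ^ 3) ∂M :=
        (integral_sub .of_finite .of_finite).symm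
    _ ≤ ∫ ω, 3 * ∑ k, totalCard Finset.univ ω ^ 2 *
          ((ω k ∩ (Finset.univ.erase k).biUnion ω).card : ℝ) ∂M := by
        refine integral_mono .of_finite .of_finite fun ω => ?_
        have h1 := card_biUnion_le_totalCard Finset.univ ω
        have h2 := totalCard_sub_card_biUnion_le Finset.univ ω
        dsimp only
        rw [← Finset.mul_sum]
        set S := totalCard Finset.univ ω
        set D : ℝ := ((Finset.univ.biUnion ω).card : ℝ)
        have hD : 0 ≤ D := Nat.cast_nonneg _
        have h3 : S ^ 3 - D ^ 3 ≤ 3 * (S ^ 2 * (S - D)) := by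
          nlinarith [mul_nonneg (sub_nonneg.2 h1) (mul_nonneg (sub_nonneg.2 h1) (add_nonneg hD hD)),
            mul_nonneg (sub_nonneg.2 h1) (mul_nonneg (sub_nonneg.2 h1) (sub_nonneg.2 h1))]
        exact h3.trans (mul_le_mul_of_nonneg_left
          (mul_le_mul_of_nonneg_left h2 (sq_nonneg S)) zero_le_three)
    _ = 3 * ∑ k, ∫ ω, ((ω k).card + totalCard (Finset.univ.erase k) ω) ^ 2 *
          ((ω k ∩ (Finset.univ.erase k).biUnion ω).card : ℝ) ∂M := by
        rw [integral_const_mul, integral_finsetSum _ fun _ _ => .of_finite]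
        congr 1
        refine Finset.sum_congr rfl fun k _ => integral_congr_ae (Eventually.of_forall fun ω => ?_)
        dsimp only
        rw [← totalCard_insert (Finset.notMem_erase k _), Finset.insert_erase (Finset.mem_univ k)]
    _ ≤ 3 * ∑ _k : ι, (2 * (Fintype.card ι * q * a) + 2 * (q * T)) := by
        refine mul_le_mul_of_nonneg_left (Finset.sum_le_sum fun k _ => ?_) zero_le_three
        refine (integral_sq_mul_card_inter_le hq hq0 k (Finset.notMem_erase k _)).trans ?_
        refine add_le_add
          (mul_le_mul_of_nonneg_left (mul_le_mul_of_nonneg_right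
            (mul_le_mul_of_nonneg_right ?_ hq0) ha0) zero_le_two)
          (mul_le_mul_of_nonneg_left (mul_le_mul_of_nonneg_left ?_ hq0) zero_le_two)
        · exact_mod_cast Finset.card_le_univ _
        · refine integral_mono .of_finite .of_finite fun ω => ?_
          dsimp only
          exact pow_le_pow_left₀ (totalCard_nonneg _ _)
            (totalCard_mono (Finset.erase_subset _ _) ω) 3
    _ = _ := by
        rw [Finset.sum_const, nsmul_eq_mul, Finset.card_univ]
        ring

end UnionOfRandomSets

section ModelDegree

variable {n m : ℕ} (z : Fin n)

theorem deg_eq_card_biUnion_layerNbrs (ω : Fin m → Layer n) :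
    deg ω z = (Finset.univ.biUnion fun k => layerNbrs z (ω k)).card := by
  have hinj : Function.Injective fun v : Fin n => s(z, v) := fun _ _ h => Sym2.congr_right.1 h
  rw [deg, ← Finset.card_image_of_injective _ hinj]
  congr 1
  ext e
  simp only [graphEdges, layerEdges, Finset.mem_filter, Finset.mem_biUnion, Finset.mem_univ,
    true_and, Finset.mem_image, mem_layerNbrs]
  constructor
  · rintro ⟨⟨k, he, hd, hV⟩, w, hw, hwz⟩
    obtain rfl := Fin.ext hwz
    obtain ⟨v, rfl⟩ := Sym2.mem_iff_exists.1 hw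
    exact ⟨v, ⟨k, he, by simpa using hd, hV _ hw, hV _ (Sym2.mem_mk_right _ _)⟩, rfl⟩
  · rintro ⟨v, ⟨k, he, hd, hz, hv⟩, rfl⟩
    refine ⟨⟨k, he, by simpa using hd, ?_⟩, z, Sym2.mem_mk_left _ _, rfl⟩
    intro w hw
    rcases Sym2.mem_iff.1 hw with rfl | rfl <;> assumption

theorem tsum_cube_mul_deg (Q : Measure (ℕ × ℝ)) [IsProbabilityMeasure Q] :
    ∑' s : ℕ, (s : ℝ) ^ 3 * (modelMeasure n m Q {ω | deg ω z = s}).toReal =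
      ∫ N, ((Finset.univ.biUnion N).card : ℝ) ^ 3
        ∂Measure.pi (fun _ : Fin m => nbrMeasure z Q) := by
  set F : (Fin m → Finset (Fin n)) → ℕ := fun N => (Finset.univ.biUnion N).card with hF
  set M := Measure.pi (fun _ : Fin m => nbrMeasure z Q) with hM
  have hFm : Measurable F := Measurable.of_discrete
  have hmap : (modelMeasure n m Q).map (fun ω k => layerNbrs z (ω k)) = M :=
    Measure.pi_map_pi fun _ => (measurable_layerNbrs z).aemeasurable
  have hmeas : Measurable fun (ω : Fin m → Layer n) k => layerNbrs z (ω k) :=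
    measurable_pi_lambda _ fun k => (measurable_layerNbrs z).comp (measurable_pi_apply k)
  have hdeg : ∀ s : ℕ, modelMeasure n m Q {ω | deg ω z = s} = M.map F {s} := by
    intro s
    rw [← hmap, Measure.map_map hFm hmeas, Measure.map_apply (hFm.comp hmeas) .of_discrete]
    simp only [deg_eq_card_biUnion_layerNbrs]
    rfl
  have hint : Integrable (fun s : ℕ => (s : ℝ) ^ 3) (M.map F) :=
    (integrable_map_measure Measurable.of_discrete.aestronglyMeasurable hFm.aemeasurable).2
      .of_finite
  rw [← integral_map (f := fun s : ℕ => (s : ℝ) ^ 3) hFm.aemeasurable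
    Measurable.of_discrete.aestronglyMeasurable, integral_countable hint]
  refine tsum_congr fun s => ?_
  rw [hdeg, smul_eq_mul, mul_comm, measureReal_def]

end ModelDegree

section Limit

/-- The third moment of a sum of `m` independent copies of a variable whose first three moments
are `a₁ / n`, `a₂ / n`, `a₃ / n`, expressed through `r = m / n` and `ε = 1 / n`; for `ε = 0` it is
the third moment of the compound Poisson limit. -/
def superpositionCube (r ε a₁ a₂ a₃ : ℝ) : ℝ :=
  r * a₃ + 3 * (r * (r - ε)) * (a₁ * a₂) + r * (r - ε) * (r - 2 * ε) * a₁ ^ 3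

theorem continuous_superpositionCube : Continuous fun p : ℝ × ℝ × ℝ × ℝ × ℝ =>
    superpositionCube p.1 p.2.1 p.2.2.1 p.2.2.2.1 p.2.2.2.2 := by
  unfold superpositionCube
  fun_prop

theorem integral_card_biUnion_cube_bounds {n m : ℕ} (z : Fin n) (Q : Measure (ℕ × ℝ))
    [IsProbabilityMeasure Q] (hQ : ∀ᵐ p ∂Q, p.1 ≤ n ∧ p.2 ∈ Set.Icc (0 : ℝ) 1) (hn : 4 ≤ n)
    {U a₃ : ℝ} (ha₃ : a₃ = mom Q 4 3 + 3 * mom Q 3 2 + mom Q 2 1)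
    (hU : U = superpositionCube (m / n) (n : ℝ)⁻¹ (mom Q 2 1) (mom Q 3 2 + mom Q 2 1) a₃) :
    U - 6 * (m / n * (mom Q 2 1 * ((n : ℝ) - 1)⁻¹)) * (m / n * a₃ + U) ≤
      ∫ N, ((Finset.univ.biUnion N).card : ℝ) ^ 3
        ∂Measure.pi (fun _ : Fin m => nbrMeasure z Q) ∧
    ∫ N, ((Finset.univ.biUnion N).card : ℝ) ^ 3
        ∂Measure.pi (fun _ : Fin m => nbrMeasure z Q) ≤ U := by
  have h₃ := integral_card_cube_nbrMeasure z Q hQ hn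
  rw [← ha₃] at h₃
  have hS := (integral_totalCard_moments (nbrMeasure z Q) (integral_card_nbrMeasure z Q hQ hn)
    (integral_card_sq_nbrMeasure z Q hQ hn) h₃ (Finset.univ : Finset (Fin m))).2.2
  have hn0 : (n : ℝ) ≠ 0 := by
    have : n ≠ 0 := by omega
    exact_mod_cast this
  rw [Finset.card_univ, Fintype.card_fin,
    show _ + _ + _ = U by rw [hU, superpositionCube]; field_simp] at hS
  have hle := integral_totalCard_cube_sub_le (ι := Fin m) (nbrMeasure_mem_le z Q hQ)
    (measureReal_nonneg.trans (nbrMeasure_mem_le z Q hQ z))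
  rw [hS, h₃, Fintype.card_fin] at hle
  constructor
  · have e : 6 * ((m : ℝ) * (mom Q 2 1 / (n * (n - 1)))) * (m * (a₃ / n) + U) =
        6 * (m / n * (mom Q 2 1 * ((n : ℝ) - 1)⁻¹)) * (m / n * a₃ + U) := by
      rw [div_eq_mul_inv (mom Q 2 1), mul_inv]
      ring
    rw [e] at hle
    linarith
  · rw [← hS]
    refine integral_mono .of_finite .of_finite fun N => ?_
    exact pow_le_pow_left₀ (Nat.cast_nonneg _) (card_biUnion_le_totalCard _ N) 3

theorem hasSum_third_moment_barf1 {mu : ℝ} (hmu : 0 ≤ mu) {P : Measure (ℕ × ℝ)}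
    (hP : ∀ᵐ p ∂P, p.2 ∈ Set.Icc (0 : ℝ) 1)
    (hint : ∀ r ≤ 3, Integrable (fun p : ℕ × ℝ => (p.1.descFactorial (r + 1) : ℝ) * p.2 ^ r) P)
    (hpos : 0 < mom P 1 0) :
    HasSum (fun s : ℕ => (s : ℝ) ^ 3 * barf1 mu P s)
      (superpositionCube mu 0 (mom P 2 1) (mom P 3 2 + mom P 2 1)
        (mom P 4 3 + 3 * mom P 3 2 + mom P 2 1)) := by
  have g0 := hasSum_descFactorial_mul_gInc 0 hP (hint 0 (by norm_num))
  have g1 := hasSum_descFactorial_mul_gInc 1 hP (hint 1 (by norm_num))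
  have g2 := hasSum_descFactorial_mul_gInc 2 hP (hint 2 (by norm_num))
  have g3 := hasSum_descFactorial_mul_gInc 3 hP (hint 3 le_rfl)
  have h₀ : HasSum (gInc P) 1 := g0.of_eq (by simp) (div_self hpos.ne').symm
  have h₁ : HasSum (fun s : ℕ => (s : ℝ) * gInc P s) (mom P 2 1 / mom P 1 0) :=
    g1.of_eq (by simp) rfl
  have h₂ := (g2.add g1).of_eq (g := fun s : ℕ => (s : ℝ) ^ 2 * gInc P s)
    (fun s => by rw [cast_pow_two_eq_descFactorial]; ring) rfl
  have h₃ := ((g3.add (g2.mul_left 3)).add g1).of_eq (g := fun s : ℕ => (s : ℝ) ^ 3 * gInc P s)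
    (fun s => by rw [cast_pow_three_eq_descFactorial]; ring) rfl
  refine (hasSum_third_moment_cpoi (mul_nonneg hmu hpos.le) (gInc_nonneg hP) h₀ h₁ h₂ h₃).of_eq
    (fun _ => rfl) ?_
  rw [superpositionCube]
  have := hpos.ne'
  field_simp
  ring

end Limit

/-- **Lemma 5** (Bloznelis–Karjalainen–Leskelä). If `m/n → μ ∈ (0,∞)`, `P⁽ⁿ⁾ → P` weakly
and `P⁽ⁿ⁾_{rs} → P_{rs} < ∞` for `rs = 10, 21, 32, 43` with `P₁₀ > 0`, then the third
moments of the model degree distribution converge: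
`Σ_s s³ f_n(s) → Σ_s s³ \bar f₁(s) < ∞`. -/
theorem degree_third_moment_tendsto
    (mu : ℝ) (hmu : 0 < mu)
    (m : ℕ → ℕ) (hm : Tendsto m atTop atTop)
    (hratio : Tendsto (fun n : ℕ => (m n : ℝ) / n) atTop (𝓝 mu))
    (Pn : ℕ → ProbabilityMeasure (ℕ × ℝ)) (P : ProbabilityMeasure (ℕ × ℝ))
    (hsupp : ∀ n, (Pn n : Measure (ℕ × ℝ)) {p : ℕ × ℝ | p.1 ≤ n ∧ p.2 ∈ Set.Icc (0:ℝ) 1} = 1)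
    (hPsupp : (P : Measure (ℕ × ℝ)) {p : ℕ × ℝ | p.2 ∈ Set.Icc (0:ℝ) 1} = 1)
    (hweak : Tendsto Pn atTop (𝓝 P))
    (hint10 : Integrable (fun p : ℕ × ℝ => (p.1.descFactorial 1 : ℝ) * p.2 ^ (0:ℕ))
      (P : Measure (ℕ × ℝ)))
    (hint21 : Integrable (fun p : ℕ × ℝ => (p.1.descFactorial 2 : ℝ) * p.2 ^ (1:ℕ))
      (P : Measure (ℕ × ℝ)))
    (hint32 : Integrable (fun p : ℕ × ℝ => (p.1.descFactorial 3 : ℝ) * p.2 ^ (2:ℕ))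
      (P : Measure (ℕ × ℝ)))
    (hint43 : Integrable (fun p : ℕ × ℝ => (p.1.descFactorial 4 : ℝ) * p.2 ^ (3:ℕ))
      (P : Measure (ℕ × ℝ)))
    (h10pos : 0 < mom (P : Measure (ℕ × ℝ)) 1 0)
    (h10 : Tendsto (fun n : ℕ => mom (Pn n : Measure (ℕ × ℝ)) 1 0) atTop
      (𝓝 (mom (P : Measure (ℕ × ℝ)) 1 0)))
    (h21 : Tendsto (fun n : ℕ => mom (Pn n : Measure (ℕ × ℝ)) 2 1) atTop
      (𝓝 (mom (P : Measure (ℕ × ℝ)) 2 1)))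
    (h32 : Tendsto (fun n : ℕ => mom (Pn n : Measure (ℕ × ℝ)) 3 2) atTop
      (𝓝 (mom (P : Measure (ℕ × ℝ)) 3 2)))
    (h43 : Tendsto (fun n : ℕ => mom (Pn n : Measure (ℕ × ℝ)) 4 3) atTop
      (𝓝 (mom (P : Measure (ℕ × ℝ)) 4 3))) :
    Summable (fun s : ℕ => (s : ℝ) ^ 3 * barf1 mu (P : Measure (ℕ × ℝ)) s) ∧
    Tendsto (fun n : ℕ =>
        ∑' s : ℕ, (s : ℝ) ^ 3 *
          ((modelMeasure n (m n) (Pn n : Measure (ℕ × ℝ))) {ω | deg ω 0 = s}).toReal) atTop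
      (𝓝 (∑' s : ℕ, (s : ℝ) ^ 3 * barf1 mu (P : Measure (ℕ × ℝ)) s)) := by
  have hPae : ∀ᵐ p ∂(P : Measure (ℕ × ℝ)), p.2 ∈ Set.Icc (0 : ℝ) 1 :=
    (mem_ae_iff_prob_eq_one (measurable_snd measurableSet_Icc)).2 hPsupp
  have hQ : ∀ n, ∀ᵐ p ∂(Pn n : Measure (ℕ × ℝ)), p.1 ≤ n ∧ p.2 ∈ Set.Icc (0 : ℝ) 1 := fun n =>
    (mem_ae_iff_prob_eq_one ((measurable_fst (.of_discrete (s := {x : ℕ | x ≤ n}))).inter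
      (measurable_snd measurableSet_Icc))).2 (hsupp n)
  have hsum := hasSum_third_moment_barf1 hmu.le hPae (fun r hr => by
    interval_cases r <;> assumption) h10pos
  refine ⟨hsum.summable, ?_⟩
  rw [hsum.tsum_eq]
  have ha₂ := h32.add h21
  have ha₃ := (h43.add (h32.const_mul 3)).add h21
  have hU := (continuous_superpositionCube.tendsto _).comp (hratio.prodMk_nhds
    ((tendsto_inv_atTop_nhds_zero_nat (𝕜 := ℝ)).prodMk_nhds
      (h21.prodMk_nhds (ha₂.prodMk_nhds ha₃))))
  have hinv : Tendsto (fun n : ℕ => ((n : ℝ) - 1)⁻¹) atTop (𝓝 0) :=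
    tendsto_inv_atTop_zero.comp
      (tendsto_atTop_add_const_right _ _ tendsto_natCast_atTop_atTop)
  have hL := hU.sub (((hratio.mul (h21.mul hinv)).const_mul 6).mul
    ((hratio.mul ha₃).add hU))
  simp only [mul_zero, zero_mul, sub_zero] at hL
  have hbounds := fun (n : ℕ) (hn : 4 ≤ n) =>
    integral_card_biUnion_cube_bounds (m := m n) (⟨0, by omega⟩ : Fin n) _ (hQ n) hn rfl rfl
  refine tendsto_of_tendsto_of_tendsto_of_le_of_le' hL hU ?_ ?_
  · filter_upwards [eventually_ge_atTop 4] with n hn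
    exact (hbounds n hn).1.trans_eq (tsum_cube_mul_deg _ _).symm
  · filter_upwards [eventually_ge_atTop 4] with n hn
    exact (tsum_cube_mul_deg (⟨0, by omega⟩ : Fin n) _).trans_le (hbounds n hn).2
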